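/- Let p be a prime, q = p^n, m ≥ 2, and let ℓ ≠ p be an odd prime and r ≥ 1 an integer such that GL_m(F_q) contains an element of order ℓ^r. If τ_q ∈ Gal(ℚ(ζ_{ℓ^r})/ℚ) is the automorphism determined by τ_q(ζ_{ℓ^r}) = ζ_{ℓ^r}^q, then K_{ℓ^r}(GL_m(F_q)) = ℚ(ζ_{ℓ^r})^{⟨τ_q⟩}, the fixed field of the cyclic subgroup generated by τ_q. -/

import Mathlib

open CategoryTheory

/-- `zeta N` is the root of unity `e^{2 π i / N}`. -/
noncomputable def zeta (N : ℕ) : ℂ := Complex.exp (2 * Real.pi * Complex.I / N)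

/-- `charField G` is the field `K(G)` generated over `ℚ` by all values of
irreducible complex characters of `G`. -/
noncomputable def charField (G : Type) [Group G] : IntermediateField ℚ ℂ :=
  IntermediateField.adjoin ℚ
    {x : ℂ | ∃ V : FDRep ℂ G, Simple V ∧ ∃ g : G, V.character g = x}

/-- `charFieldAt G d` is the field `K_d(G)` generated over `ℚ` by the values of
irreducible complex characters of `G` at elements of order exactly `d`. -/
noncomputable def charFieldAt (G : Type) [Group G] (d : ℕ) : IntermediateField ℚ ℂ :=
  IntermediateField.adjoin ℚ
    {x : ℂ | ∃ V : FDRep ℂ G, Simple V ∧ ∃ g : G, orderOf g = d ∧ V.character g = x}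

section

open scoped MonoidAlgebra

/-- Schur: for a finite-dimensional irreducible representation, the difference of class sums of two elements with equal character vanishes. -/
theorem sum_conj_eq_of_character_eq {G V : Type*} [Group G] [Fintype G] [AddCommGroup V]
    [Module ℂ V] [FiniteDimensional ℂ V] (ρ : Representation ℂ G V) [ρ.IsIrreducible] {g h : G}
    (hgh : ρ.character g = ρ.character h) :
    ∑ y : G, ρ (y * g * y⁻¹) = ∑ y : G, ρ (y * h * y⁻¹) := by
  have comm (a x : G) : (∑ y : G, ρ (y * a * y⁻¹)) * ρ x = ρ x * ∑ y : G, ρ (y * a * y⁻¹) := by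
    rw [Finset.sum_mul, Finset.mul_sum]
    refine Fintype.sum_equiv (Equiv.mulLeft x⁻¹) _ _ fun y ↦ ?_
    rw [← map_mul, ← map_mul]
    congr 1
    simp [mul_assoc]
  let T : Representation.IntertwiningMap ρ ρ :=
    ⟨∑ y : G, ρ (y * g * y⁻¹) - ∑ y : G, ρ (y * h * y⁻¹), fun x ↦ by
      rw [← Module.End.mul_eq_comp, ← Module.End.mul_eq_comp, sub_mul, mul_sub, comm, comm]⟩
  obtain ⟨c, hc⟩ :=
    (Representation.IsIrreducible.algebraMap_intertwiningMap_bijective_of_isAlgClosed (ρ := ρ)).2 T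
  have hT : ∑ y : G, ρ (y * g * y⁻¹) - ∑ y : G, ρ (y * h * y⁻¹) = c • (1 : Module.End ℂ V) :=
    congrArg Representation.IntertwiningMap.toLinearMap hc.symm
  have htr := congrArg (LinearMap.trace ℂ V) hT
  have hchar (a y : G) : LinearMap.trace ℂ V (ρ (y * a * y⁻¹)) = ρ.character a :=
    ρ.char_conj a y
  simp only [map_sub, map_sum, hchar, hgh, sub_self, map_smul, LinearMap.trace_one,
    smul_eq_mul] at htr
  rw [← sub_eq_zero, hT]
  rcases mul_eq_zero.mp htr.symm with h0 | h0
  · rw [h0, zero_smul]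
  · have := Module.finrank_zero_iff.mp (Nat.cast_eq_zero.mp h0)
    exact Subsingleton.elim _ _

theorem simple_fdRep_of {G V : Type} [Group G] [Finite G] [AddCommGroup V]
    [Module ℂ V] [FiniteDimensional ℂ V] (ρ : Representation ℂ G V) [ρ.IsIrreducible] :
    Simple (FDRep.of ρ) := by
  have := Fintype.ofFinite G
  rw [FDRep.simple_iff_char_is_norm_one]
  have : Invertible (Nat.card G : ℂ) := invertibleOfNonzero (NeZero.ne _)
  have h := Representation.char_orthonormal ρ ρ
  rw [if_pos ⟨Representation.Equiv.refl ρ⟩] at h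
  have h' := congrArg ((Nat.card G : ℂ) * ·) h
  rw [Nat.card_eq_fintype_card] at h'
  simpa [FDRep.character, Representation.character] using h'

theorem asModuleEquiv_ofModule'_smul {G M : Type*} [Group G] [AddCommGroup M]
    [Module ℂ M] [Module ℂ[G] M] [IsScalarTower ℂ ℂ[G] M] (a : ℂ[G])
    (v : (Representation.ofModule' (k := ℂ) (G := G) M).asModule) :
    (Representation.ofModule' (k := ℂ) (G := G) M).asModuleEquiv (a • v) =
      a • (Representation.ofModule' (k := ℂ) (G := G) M).asModuleEquiv v := by
  rw [Representation.asModuleEquiv_map_smul, Representation.asAlgebraHom_def,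
    Representation.ofModule', Equiv.apply_symm_apply, Algebra.lsmul_coe]

theorem irreducible_ofModule' {G M : Type*} [Group G] [AddCommGroup M]
    [Module ℂ M] [Module ℂ[G] M] [IsScalarTower ℂ ℂ[G] M] [IsSimpleModule ℂ[G] M] :
    (Representation.ofModule' (k := ℂ) (G := G) M).IsIrreducible := by
  rw [Representation.irreducible_iff_isSimpleModule_asModule]
  let e : (Representation.ofModule' (k := ℂ) (G := G) M).asModule ≃ₗ[ℂ[G]] M :=
    { (Representation.ofModule' (k := ℂ) (G := G) M).asModuleEquiv.toAddEquiv with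
      map_smul' := asModuleEquiv_ofModule'_smul }
  exact IsSimpleModule.congr e

theorem isConj_of_forall_character_eq {G : Type} [Group G] [Finite G] {g h : G}
    (hgh : ∀ V : FDRep ℂ G, Simple V → V.character g = V.character h) : IsConj g h := by
  classical
  have := Fintype.ofFinite G
  let S (a : G) : ℂ[G] := ∑ y : G, MonoidAlgebra.single (y * a * y⁻¹) (1 : ℂ)
  have hS : S g - S h = 0 := by
    have hj : Ring.jacobson ℂ[G] = ⊥ := IsSemisimpleModule.jacobson_eq_bot _ _
    rw [← Ideal.mem_bot, ← hj, Ring.jacobson, Module.jacobson, Submodule.mem_sInf]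
    intro I hI
    have : IsSimpleModule ℂ[G] (ℂ[G] ⧸ I) := isSimpleModule_iff_isCoatom.mpr hI
    let ρ := Representation.ofModule' (k := ℂ) (G := G) (ℂ[G] ⧸ I)
    have : ρ.IsIrreducible := irreducible_ofModule'
    have hρ (a : G) (v) : ρ a v = MonoidAlgebra.single a (1 : ℂ) • v := rfl
    have e := sum_conj_eq_of_character_eq ρ (hgh _ (simple_fdRep_of ρ))
    have e1 := congrArg (fun f ↦ f (Submodule.Quotient.mk (1 : ℂ[G]))) e
    simp only [LinearMap.sum_apply, hρ] at e1
    rw [← Finset.sum_smul, ← Finset.sum_smul, ← Submodule.Quotient.mk_smul,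
      ← Submodule.Quotient.mk_smul, Submodule.Quotient.eq] at e1
    simpa [S] using e1
  by_contra hc
  have hco (a b : G) : (S a).coeff b = ∑ y : G, if y * a * y⁻¹ = b then (1 : ℂ) else 0 := by
    simp [S, MonoidAlgebra.coeff_sum, Finsupp.single_apply]
  have hne (y : G) : y * h * y⁻¹ ≠ g := fun he ↦
    hc (isConj_comm.mp (isConj_iff.mpr ⟨y, he⟩))
  have heq : (S g).coeff g = (S h).coeff g := by rw [sub_eq_zero.mp hS]
  rw [hco, hco, Finset.sum_eq_zero (f := fun y ↦ if y * h * y⁻¹ = g then (1 : ℂ) else 0)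
    fun y _ ↦ if_neg (hne y), Finset.sum_boole, Nat.cast_eq_zero, Finset.card_eq_zero] at heq
  exact (Finset.filter_eq_empty_iff.mp heq (Finset.mem_univ 1)) (by simp)

end

section

open Polynomial

/-- Traces of powers of an endomorphism of finite order. -/
theorem exists_trace_pow_eq_sum {V : Type*} [AddCommGroup V] [Module ℂ V] [FiniteDimensional ℂ V]
    {N : ℕ} (hN : N ≠ 0) {ω : ℂ} (hω : IsPrimitiveRoot ω N) {A : Module.End ℂ V} (hA : A ^ N = 1) :
    ∃ c : ℕ → ℕ, ∀ k, LinearMap.trace ℂ V (A ^ k) = ∑ j ∈ Finset.range N, c j * ω ^ (j * k) := by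
  have hω0 : ω ≠ 0 := hω.ne_zero hN
  have hN' : (N : ℂ) ≠ 0 := Nat.cast_ne_zero.mpr hN
  let e (j : ℕ) : Module.End ℂ V := (N : ℂ)⁻¹ • ∑ i ∈ Finset.range N, ((ω ^ j)⁻¹ • A) ^ i
  have hB (j : ℕ) : ((ω ^ j)⁻¹ • A) ^ N = 1 := by
    rw [_root_.smul_pow, hA, inv_pow, ← pow_mul, mul_comm, pow_mul, hω.pow_eq_one, one_pow, inv_one,
      one_smul]
  have hBe (j : ℕ) : ((ω ^ j)⁻¹ • A) * e j = e j := by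
    have := mul_geom_sum ((ω ^ j)⁻¹ • A) N
    rw [hB, sub_self, sub_mul, one_mul, sub_eq_zero] at this
    rw [mul_smul_comm, this]
  have hBpow (j i : ℕ) : ((ω ^ j)⁻¹ • A) ^ i * e j = e j := by
    induction i with
    | zero => simp
    | succ i ih => rw [pow_succ, mul_assoc, hBe, ih]
  have hAe (j k : ℕ) : A ^ k * e j = ω ^ (j * k) • e j := by
    conv_rhs => rw [← hBpow j k]
    rw [_root_.smul_pow, smul_mul_assoc, smul_smul, inv_pow, ← pow_mul,
      mul_inv_cancel₀ (pow_ne_zero _ hω0), one_smul]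
  have hidem (j : ℕ) : IsIdempotentElem (e j) := by
    change e j * e j = e j
    conv_lhs => enter [1]; simp only [e]
    rw [smul_mul_assoc, Finset.sum_mul, Finset.sum_congr rfl fun i _ ↦ hBpow j i]
    simp [← Nat.cast_smul_eq_nsmul ℂ, smul_smul, hN']
  have hsum : ∑ j ∈ Finset.range N, e j = 1 := by
    simp only [e, ← Finset.smul_sum]
    rw [Finset.sum_comm, Finset.sum_eq_single 0]
    · simp [← Nat.cast_smul_eq_nsmul ℂ, smul_smul, hN']
    · intro i hi hi0
      have hx : (ω ^ i)⁻¹ ≠ 1 := by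
        rw [ne_eq, inv_eq_one]
        exact hω.pow_ne_one_of_pos_of_lt hi0 (Finset.mem_range.mp hi)
      have h0 : ∑ j ∈ Finset.range N, ((ω ^ i)⁻¹) ^ j = 0 := by
        have := mul_geom_sum (ω ^ i)⁻¹ N
        rw [inv_pow, ← pow_mul, mul_comm i, pow_mul, hω.pow_eq_one, one_pow, inv_one,
          sub_self] at this
        exact (mul_eq_zero.mp this).resolve_left (sub_ne_zero.mpr hx)
      simp only [_root_.smul_pow, inv_pow, ← pow_mul] at h0 ⊢
      simp only [mul_comm _ i, ← Finset.sum_smul, h0, zero_smul]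
    · simp [hN]
  refine ⟨fun j ↦ Module.finrank ℂ (LinearMap.range (e j)), fun k ↦ ?_⟩
  rw [← mul_one (A ^ k), ← hsum, Finset.mul_sum, map_sum]
  refine Finset.sum_congr rfl fun j _ ↦ ?_
  rw [hAe, map_smul, (LinearMap.IsIdempotentElem.isProj_range (e j) (hidem j)).trace, smul_eq_mul,
    mul_comm]

theorem isConj_pow_card {F : Type*} [Field F] [Fintype F] {ι : Type*} [Fintype ι] [DecidableEq ι]
    (g : GL ι F) {N : ℕ} (hN : (N : F) ≠ 0) (hg : g ^ N = 1) : IsConj g (g ^ Fintype.card F) := by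
  let A : Module.End F (ι → F) := Matrix.toLinAlgEquiv' g.1
  have hA : A.IsSemisimple := by
    refine Module.End.isSemisimple_of_squarefree_aeval_eq_zero (p := X ^ N - C 1)
      (separable_X_pow_sub_C (1 : F) hN one_ne_zero).squarefree ?_
    have : A ^ N = 1 := by
      rw [← map_pow, ← Units.val_pow_eq_pow_val, hg, Units.val_one, map_one]
    simp [this]
  let M := Module.AEval' A
  have : IsSemisimpleModule F[X] M := hA
  obtain ⟨s, e, -, hs⟩ := IsSemisimpleModule.exists_linearEquiv_dfinsupp F[X] M
  have key (S : s) : ∃ T : S.1 →+ S.1, Function.Injective T ∧ (∀ (c : F) v, T (C c • v) = C c • T v) ∧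
        ∀ v, T ((X : F[X]) • v) = (X ^ Fintype.card F : F[X]) • T v := by
    obtain ⟨I, hI, ⟨φ⟩⟩ := isSimpleModule_iff_quot_maximal.mp (hs S)
    let : Field (F[X] ⧸ I) := Ideal.Quotient.field I
    let fr := FiniteField.frobeniusAlgHom F (F[X] ⧸ I)
    have hmul (f : F[X]) (v : F[X] ⧸ I) : f • v = Ideal.Quotient.mk I f * v := by
      rw [Algebra.smul_def, Ideal.Quotient.algebraMap_eq]
    refine ⟨φ.symm.toAddMonoidHom.comp (fr.toLinearMap.toAddMonoidHom.comp φ.toAddMonoidHom),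
      φ.symm.injective.comp (fr.toRingHom.injective.comp φ.injective), fun c v ↦ ?_, fun v ↦ ?_⟩
    · change φ.symm (fr (φ (C c • v))) = C c • φ.symm (fr (φ v))
      rw [← map_smul, map_smul φ, hmul, hmul, map_mul]
      congr 2
      exact fr.commutes c
    · change φ.symm (fr (φ ((X : F[X]) • v))) = (X ^ Fintype.card F : F[X]) • φ.symm (fr (φ v))
      rw [← map_smul, map_smul φ, hmul, hmul, map_mul, map_pow]
      rfl
  choose T hinj hC hX using key
  let Φ : (Π₀ S : s, S.1) →+ (Π₀ S : s, S.1) := DFinsupp.mapRange.addMonoidHom T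
  have hΦ (v) (S : s) : Φ v S = T S (v S) := rfl
  let u : (ι → F) ≃ₗ[F] M := Module.AEval'.of A
  have hu (v) : u (A v) = (X : F[X]) • u v := (Module.AEval'.X_smul_of A v).symm
  have hu' (k : ℕ) (v) : u ((A ^ k) v) = (X ^ k : F[X]) • u v :=
    (Module.AEval'.X_pow_smul_of A v k).symm
  have huC (c : F) (v) : u (c • v) = C c • u v := by
    rw [map_smul]; exact (Module.AEval.C_smul ..).symm
  let ψ : (ι → F) →ₗ[F] (ι → F) :=
    { toFun v := u.symm (e.symm (Φ (e (u v))))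
      map_add' v w := by simp
      map_smul' c v := by
        rw [LinearEquiv.symm_apply_eq, RingHom.id_apply, huC, huC, LinearEquiv.apply_symm_apply,
          map_smul, ← map_smul e.symm]
        congr 1
        ext1 S
        exact hC S .. }
  have hψ : Function.Injective ψ := by
    refine u.symm.injective.comp (e.symm.injective.comp (Function.Injective.comp (fun v w h ↦ ?_)
      (e.injective.comp u.injective)))
    ext1 S
    exact hinj S (congrArg (· S) h)
  have hψA : ψ * A = A ^ Fintype.card F * ψ := by
    refine LinearMap.ext fun v ↦ ?_
    change u.symm (e.symm (Φ (e (u (A v))))) = (A ^ Fintype.card F) (ψ v)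
    rw [LinearEquiv.symm_apply_eq, hu', hu, map_smul]
    change _ = _ • u (u.symm (e.symm (Φ (e (u v)))))
    rw [LinearEquiv.apply_symm_apply, ← map_smul e.symm]
    congr 1
    ext1 S
    exact hX S _
  have hunit : IsUnit ψ := LinearMap.isUnit_iff_ker_eq_bot ψ |>.mpr (LinearMap.ker_eq_bot.mpr hψ)
  obtain ⟨P, hP⟩ := hunit.map (Matrix.toLinAlgEquiv' (R := F) (n := ι)).symm
  refine ⟨toUnits P, Units.ext ?_⟩
  have h := congrArg (Matrix.toLinAlgEquiv' (R := F) (n := ι)).symm hψA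
  rw [map_mul, map_mul, map_pow, AlgEquiv.symm_apply_apply] at h
  simpa [hP] using h

/-- A general linear group with an element of order `ℓ ^ (r + 1)` has degree at least that of some
irreducible factor of the cyclotomic polynomial. -/
theorem exists_irreducible_dvd_cyclotomic {F : Type*} [Field F] {m ℓ r : ℕ}
    (hℓ : ℓ.Prime) {g : GL (Fin m) F} (hg : orderOf g = ℓ ^ (r + 1)) :
    ∃ f : F[X], Irreducible f ∧ f ∣ cyclotomic (ℓ ^ (r + 1)) F ∧ f.natDegree ≤ m := by
  have := Fact.mk hℓ
  have hlt : ℓ ^ r < ℓ ^ (r + 1) := Nat.pow_lt_pow_right hℓ.one_lt r.lt_succ_self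
  have hdvd (k : ℕ) : minpoly F g.1 ∣ X ^ k - 1 ↔ g ^ k = 1 := by
    rw [minpoly.dvd_iff]
    simp [sub_eq_zero, Units.ext_iff]
  have hncop : ¬ IsCoprime (minpoly F g.1) (cyclotomic (ℓ ^ (r + 1)) F) := by
    intro hcop
    have h1 := (hdvd _).mpr (hg ▸ pow_orderOf_eq_one g)
    rw [← cyclotomic_prime_pow_mul_X_pow_sub_one] at h1
    have h2 := orderOf_dvd_of_pow_eq_one ((hdvd _).mp (hcop.dvd_of_dvd_mul_left h1))
    exact absurd (Nat.le_of_dvd (pow_pos hℓ.pos r) (hg ▸ h2)) (not_le.mpr hlt)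
  by_contra! hno
  refine hncop (isCoprime_of_irreducible_dvd (fun h ↦ cyclotomic_ne_zero _ F h.2)
    fun f hf hfm hfc ↦ (hno f hf hfc).not_ge ?_)
  have h := hfm.trans (Matrix.minpoly_dvd_charpoly g.1)
  simpa using natDegree_le_of_dvd h (Matrix.charpoly_monic _).ne_zero

theorem SemiconjBy.polynomial_aeval {R A : Type*} [CommSemiring R] [Semiring A] [Algebra R A]
    {c a b : A} (h : SemiconjBy c a b) (P : R[X]) : SemiconjBy c (aeval a P) (aeval b P) := by
  induction P using Polynomial.induction_on' with
  | add P Q hP hQ => simpa using hP.add_right hQ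
  | monomial n r =>
    rw [aeval_monomial, aeval_monomial]
    exact SemiconjBy.mul_right (Algebra.commutes r c).symm (h.pow_right n)

theorem exists_orderOf_eq_and_isConj_pow {F : Type*} [Field F] [Fintype F] {m ℓ r : ℕ}
    (hℓ : ℓ.Prime) (hℓF : (ℓ : F) ≠ 0) (hex : ∃ g : GL (Fin m) F, orderOf g = ℓ ^ (r + 1)) :
    ∃ g : GL (Fin m) F, orderOf g = ℓ ^ (r + 1) ∧ ∀ k : ℕ, k.Coprime ℓ → IsConj g (g ^ k) →
      ∃ i : ℕ, k ≡ Fintype.card F ^ i [MOD ℓ ^ (r + 1)] := by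
  obtain ⟨g₀, hg₀⟩ := hex
  obtain ⟨f, hf, hfc, hfm⟩ := exists_irreducible_dvd_cyclotomic hℓ hg₀
  have := Fact.mk hf
  let L := AdjoinRoot f
  let ζ : L := AdjoinRoot.root f
  have : Module.Finite F L := (AdjoinRoot.powerBasis hf.ne_zero).finite
  have : Finite L := Module.finite_of_finite F
  have hfζ : aeval ζ f = 0 := by rw [AdjoinRoot.aeval_eq, AdjoinRoot.mk_self]
  have hζ : IsPrimitiveRoot ζ (ℓ ^ (r + 1)) := by
    have : NeZero ((ℓ ^ (r + 1) : ℕ) : L) := ⟨by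
      rw [← map_natCast (algebraMap F L), Nat.cast_pow]
      exact (_root_.map_ne_zero _).mpr (pow_ne_zero _ hℓF)⟩
    rw [← isRoot_cyclotomic_iff, ← map_cyclotomic (ℓ ^ (r + 1)) (algebraMap F L), IsRoot.def,
      eval_map_algebraMap]
    exact aeval_eq_zero_of_dvd_aeval_eq_zero hfc hfζ
  let V := L × (Fin (m - f.natDegree) → F)
  have hrank : Module.finrank F V = m := by
    rw [Module.finrank_prod, Module.finrank_fin_fun, (AdjoinRoot.powerBasis hf.ne_zero).finrank,
      AdjoinRoot.powerBasis_dim, Nat.add_sub_cancel' hfm]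
  let Ψ : L × F →ₐ[F] Module.End F V := (LinearMap.prodMapAlgHom F L _).comp
    (AlgHom.prodMap (Algebra.lmul F L) (Algebra.ofId F _))
  have hΨ (x : L × F) (hx : Ψ x = 0) : x.1 = 0 := by
    have h : (Ψ x (1, 0)).1 = 0 := by rw [hx]; rfl
    exact (mul_one x.1).symm.trans h
  let φ : Module.End F V ≃ₐ[F] Matrix (Fin m) (Fin m) F :=
    LinearMap.toMatrixAlgEquiv (Module.finBasisOfFinrankEq F V hrank)
  let θ : L × F →ₐ[F] Matrix (Fin m) (Fin m) F := φ.toAlgHom.comp Ψ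
  have hθ (x : L × F) (hx : θ x = 0) : x.1 = 0 :=
    hΨ x ((map_eq_zero_iff φ φ.injective).mp hx)
  let x : L × F := (ζ, 1)
  have hxpow (k : ℕ) : x ^ k = (ζ ^ k, 1) := by simp [x]
  have hθ1 (k : ℕ) : θ x ^ k = 1 ↔ ζ ^ k = 1 := by
    rw [← map_pow, hxpow]
    refine ⟨fun h ↦ sub_eq_zero.mp (hθ ((ζ ^ k, 1) - 1) ?_), fun h ↦ ?_⟩
    · rw [map_sub, h, map_one, sub_self]
    · rw [h]; exact map_one θ
  let g : GL (Fin m) F := Units.ofPowEqOne (θ x) _ ((hθ1 _).mpr hζ.pow_eq_one)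
    (pow_ne_zero _ hℓ.ne_zero)
  have hg : (g : Matrix (Fin m) (Fin m) F) = θ x := rfl
  refine ⟨g, ?_, fun k hk hc ↦ ?_⟩
  · rw [hζ.eq_orderOf, orderOf_eq_orderOf_iff]
    intro k
    rw [← hθ1, ← hg, ← Units.val_pow_eq_pow_val, Units.val_eq_one]
  have haeval (k : ℕ) (P : F[X]) : aeval (θ x ^ k) P = θ (aeval (ζ ^ k) P, aeval 1 P) := by
    rw [← map_pow, hxpow, aeval_algHom_apply, aeval_prod_apply]
  have hroot : aeval (ζ ^ k) (f * (X - 1)) = 0 := by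
    obtain ⟨c, hc⟩ := hc
    have hc' : SemiconjBy c.1.1 (θ x) (θ x ^ k) := by
      have := congrArg Units.val hc
      simpa [SemiconjBy, hg] using this
    have h := hc'.polynomial_aeval (f * (X - 1))
    have h0 : aeval (θ x) (f * (X - 1)) = 0 := by
      have := haeval 1 (f * (X - 1))
      rw [pow_one, pow_one] at this
      rw [this]
      simp only [map_mul, hfζ, map_sub, aeval_X, map_one, sub_self, mul_zero, zero_mul]
      exact map_zero θ
    rw [SemiconjBy, h0, mul_zero] at h
    have h1 := (Units.mul_left_eq_zero c.1).mp h.symm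
    rw [haeval] at h1
    exact hθ _ h1
  have hζk : ζ ^ k ≠ 1 := fun h ↦ by
    have h1 := Nat.dvd_gcd (hζ.dvd_of_pow_eq_one k h |> (dvd_pow_self ℓ r.succ_ne_zero).trans)
      dvd_rfl
    rw [hk.gcd_eq_one] at h1
    exact hℓ.one_lt.ne' (Nat.dvd_one.mp h1)
  have hfk : aeval (ζ ^ k) f = 0 := by
    rw [map_mul] at hroot
    refine (mul_eq_zero.mp hroot).resolve_right ?_
    simpa [sub_eq_zero] using hζk
  let σ : L →ₐ[F] L := AdjoinRoot.liftAlgHom f (Algebra.ofId F L) (ζ ^ k) hfk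
  obtain ⟨i, hi⟩ := (FiniteField.bijective_frobeniusAlgHom_pow F L).2 σ
  have hσ : σ ζ = ζ ^ k := AdjoinRoot.liftAlgHom_root ..
  have hfrob (j : ℕ) : (FiniteField.frobeniusAlgHom F L ^ j) ζ = ζ ^ Fintype.card F ^ j := by
    induction j with
    | zero => simp
    | succ j ih =>
      rw [pow_succ', AlgHom.mul_apply, ih, pow_succ, pow_mul]
      rfl
  refine ⟨i, ?_⟩
  have hp : ζ ^ k = ζ ^ Fintype.card F ^ i.1 := by rw [← hσ, ← hi, ← hfrob]
  rw [hζ.eq_orderOf]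
  have hu := hζ.isUnit (pow_ne_zero _ hℓ.ne_zero)
  rw [← hu.unit_spec, orderOf_units, ← pow_eq_pow_iff_modEq, Units.ext_iff]
  simpa using hp

end

/-- The Galois action on character values at elements of order dividing `N`. -/
theorem exists_coe_eq_character {G : Type} [Group G] (V : FDRep ℂ G) {N : ℕ} (hN : N ≠ 0)
    {z : ℂ} (hz : IsPrimitiveRoot z N) {g : G} (hg : g ^ N = 1) {L : IntermediateField ℚ ℂ}
    (w : L) (hw : (w : ℂ) = z) :
    ∃ x : L, (x : ℂ) = V.character g ∧
      ∀ (σ : L ≃ₐ[ℚ] L) (k : ℕ), σ w = w ^ k → (σ x : ℂ) = V.character (g ^ k) := by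
  obtain ⟨c, hc⟩ := exists_trace_pow_eq_sum hN hz (A := V.ρ g) (by rw [← map_pow, hg, map_one])
  refine ⟨∑ j ∈ Finset.range N, c j * w ^ j, ?_, fun σ k hσ ↦ ?_⟩
  · have := hc 1
    rw [pow_one] at this
    simp [FDRep.character, this, hw]
  · rw [FDRep.character, map_pow, hc k]
    simp [hσ, hw, ← pow_mul, mul_comm]

theorem isGalois_of_eq_adjoin_primitiveRoot {K E : Type*} [Field K] [Field E] [Algebra K E] {N : ℕ}
    [NeZero N] {L : IntermediateField K E} {w : L} (hw : IsPrimitiveRoot w N)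
    (hL : L = IntermediateField.adjoin K {(w : E)}) :
    IsGalois K L ∧ FiniteDimensional K L ∧ ∀ σ ρ : L ≃ₐ[K] L, σ w = ρ w → σ = ρ := by
  have hz : IsPrimitiveRoot (w : E) N := IsPrimitiveRoot.coe_submonoidClass_iff.mpr hw
  have hcyc : IsCyclotomicExtension {N} K (IntermediateField.adjoin K {(w : E)}) := by
    change IsCyclotomicExtension {N} K (IntermediateField.adjoin K {(w : E)}).toSubalgebra
    rw [IntermediateField.adjoin_simple_toSubalgebra_of_isAlgebraic
      (hz.isIntegral (NeZero.pos N)).tower_top.isAlgebraic]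
    exact hz.adjoin_isCyclotomicExtension K
  rw [← hL] at hcyc
  exact ⟨IsCyclotomicExtension.isGalois {N} K L, IsCyclotomicExtension.finiteDimensional {N} K L,
    fun σ ρ h ↦ AlgEquiv.coe_toAlgHom_injective
      ((hw.powerBasis K).algHom_ext (by simpa using h))⟩

/-- If every element of order `N` is conjugate to its `q`-th power, and some element of order `N` is
conjugate to no other powers than those by powers of `q`, then `charFieldAt G N` is the fixed field
of the automorphism raising the `N`-th roots of unity to the power `q`. -/
theorem charFieldAt_eq_map_fixedField {G : Type} [Group G] [Finite G] {N q : ℕ} (hN : N ≠ 0)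
    {z : ℂ} (hz : IsPrimitiveRoot z N) {L : IntermediateField ℚ ℂ}
    (hL : L = IntermediateField.adjoin ℚ {z}) {w : L} (hwz : (w : ℂ) = z) {τ : L ≃ₐ[ℚ] L}
    (hτ : τ w = w ^ q) (hconj : ∀ g : G, orderOf g = N → IsConj g (g ^ q))
    (hex : ∃ g : G, orderOf g = N ∧ ∀ k : ℕ, k.Coprime N → IsConj g (g ^ k) →
      ∃ i : ℕ, k ≡ q ^ i [MOD N]) :
    charFieldAt G N = (IntermediateField.fixedField (Subgroup.zpowers τ)).map L.val := by
  have : NeZero N := ⟨hN⟩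
  have hw : IsPrimitiveRoot w N := IsPrimitiveRoot.coe_submonoidClass_iff.mp (hwz ▸ hz)
  have hτpow (i : ℕ) : (τ ^ i) w = w ^ q ^ i := by
    induction i with
    | zero => simp
    | succ i ih => rw [pow_succ', AlgEquiv.mul_apply, ih, map_pow, hτ, ← pow_mul, ← pow_succ']
  obtain ⟨hGal, hfin, hext⟩ := isGalois_of_eq_adjoin_primitiveRoot hw (hwz ▸ hL)
  have hchar (V : FDRep ℂ G) {g : G} (hg : orderOf g = N) :=
    exists_coe_eq_character V hN hz (hg ▸ pow_orderOf_eq_one g) w hwz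
  refine le_antisymm (IntermediateField.adjoin_le_iff.mpr ?_) ?_
  · rintro _ ⟨V, -, g, hg, rfl⟩
    obtain ⟨x, hx, hxσ⟩ := hchar V hg
    refine ⟨x, ?_, hx⟩
    have hτx : τ x = x := Subtype.ext <| by
      rw [hxσ τ q hτ, hx]
      obtain ⟨c, hc⟩ := isConj_iff.mp (hconj g hg)
      rw [← hc, FDRep.char_conj]
    have hmem : Subgroup.zpowers τ ≤ MulAction.stabilizer (L ≃ₐ[ℚ] L) x :=
      Subgroup.zpowers_le.mpr hτx
    exact fun σ ↦ hmem σ.2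
  let K := (charFieldAt G N).comap L.val
  suffices h : IntermediateField.fixedField (Subgroup.zpowers τ) ≤ K from
    IntermediateField.map_le_iff_le_comap.mpr h
  rw [← IsGalois.fixedField_fixingSubgroup K]
  refine IntermediateField.fixedField_antitone fun σ hσ ↦ ?_
  obtain ⟨k, -, hk, hσk⟩ := hw.isPrimitiveRoot_iff.mp (hw.map_of_injective σ.injective)
  obtain ⟨g, hg, hgk⟩ := hex
  obtain ⟨i, hi⟩ := hgk k hk (isConj_of_forall_character_eq fun V hV ↦ by
    obtain ⟨x, hx, hxσ⟩ := hchar V hg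
    rw [← hxσ σ k hσk.symm, ← hx]
    have hxK : x ∈ K := by
      change (x : ℂ) ∈ charFieldAt G N
      rw [hx]
      exact IntermediateField.subset_adjoin _ _ ⟨V, hV, g, hg, rfl⟩
    exact congrArg Subtype.val ((IntermediateField.mem_fixingSubgroup_iff _ _).mp hσ x hxK).symm)
  refine ⟨i, hext _ _ ?_⟩
  change (τ ^ (i : ℤ)) w = σ w
  rw [zpow_natCast, hτpow, ← hσk, pow_eq_pow_mod (q ^ i) hw.pow_eq_one,
    pow_eq_pow_mod k hw.pow_eq_one, hi]

/-- If `ℓ ≠ p` is an odd prime, `GL_m(F_q)` has an element of order `ℓ^r`,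
and `τ_q ∈ Gal(ℚ(ζ_{ℓ^r})/ℚ)` satisfies `τ_q(ζ_{ℓ^r}) = ζ_{ℓ^r}^q`, then
`K_{ℓ^r}(GL_m(F_q))` is the fixed field of `⟨τ_q⟩`. -/
theorem statement2 (p n m q ℓ r : ℕ) (hp : p.Prime) (hn : 1 ≤ n) (hm : 2 ≤ m)
    (hq : q = p ^ n) (hℓ : ℓ.Prime) (hodd : Odd ℓ) (hne : ℓ ≠ p) (hr : 1 ≤ r)
    (F : Type) [Field F] [Fintype F] (hF : Fintype.card F = q)
    (hex : ∃ g : GL (Fin m) F, orderOf g = ℓ ^ r)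
    (τ : ↥(IntermediateField.adjoin ℚ {zeta (ℓ ^ r)}) ≃ₐ[ℚ]
         ↥(IntermediateField.adjoin ℚ {zeta (ℓ ^ r)}))
    (hτ : ∀ x : ↥(IntermediateField.adjoin ℚ {zeta (ℓ ^ r)}),
      (x : ℂ) = zeta (ℓ ^ r) → (τ x : ℂ) = zeta (ℓ ^ r) ^ q) :
    charFieldAt (GL (Fin m) F) (ℓ ^ r) =
      (IntermediateField.fixedField (Subgroup.zpowers τ)).map
        (IntermediateField.adjoin ℚ {zeta (ℓ ^ r)}).val := by
  obtain ⟨r, rfl⟩ := Nat.exists_eq_add_of_le' hr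
  have hN : ℓ ^ (r + 1) ≠ 0 := pow_ne_zero _ hℓ.ne_zero
  have hℓF : (ℓ : F) ≠ 0 := fun h ↦ by
    have := Fact.mk hp
    have : CharP F p := charP_of_card_eq_prime_pow (hF.trans hq)
    rw [CharP.cast_eq_zero_iff F p, Nat.prime_dvd_prime_iff_eq hp hℓ] at h
    exact hne h.symm
  let w : IntermediateField.adjoin ℚ {zeta (ℓ ^ (r + 1))} :=
    ⟨zeta (ℓ ^ (r + 1)), IntermediateField.mem_adjoin_simple_self ℚ _⟩
  refine charFieldAt_eq_map_fixedField (q := q) hN (Complex.isPrimitiveRoot_exp _ hN) rfl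
    (w := w) rfl (Subtype.ext (hτ w rfl)) (fun g hg ↦ ?_) ?_
  · rw [← hF]
    exact isConj_pow_card g (by rw [Nat.cast_pow]; exact pow_ne_zero _ hℓF)
      (hg ▸ pow_orderOf_eq_one g)
  · rw [← hF]
    obtain ⟨g, hg, hgk⟩ := exists_orderOf_eq_and_isConj_pow hℓ hℓF hex
    exact ⟨g, hg, fun k hk ↦ hgk k (hk.coprime_dvd_right (dvd_pow_self ℓ r.succ_ne_zero))⟩
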